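/- arXiv:2504.13740 — 3 statements merged into one kernel-verified Lean document; each statement's English description precedes it below -/
import Mathlib

section
/- Let f : S → Bool be any function assigning to each encoder state its most recent input bit (so that the information bit at time t is b_t = f(S_t)). Then the serial and parallel a-posteriori probabilities of the information bits coincide: for every t ∈ {1,…,L} and every observation sequence y with P(Y = y) > 0, one has P(f(S_t) = 0 | Y = y) = P(f(S_t) = 0 | Y_{i(t)} = y|_{i(t)}). (Note that P(Y = y) > 0 implies P(Y_{i(t)} = y|_{i(t)}) > 0, so both conditional probabilities are defined.) -/
/-!
Finite hidden Markov source over a memoryless channel.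
States `S` (with distinguished state `0`), channel output symbols `O`.
A state path is `s : Fin (L+1) → S`; an observation sequence is `y : Fin L → O`,
where index `t : Fin L` represents time `t+1 ∈ {1,…,L}`.
-/

open scoped Classical in
/-- The probability of an event `A` under the mass function `P`. -/
noncomputable def prob {S O : Type*} [Fintype S] [Fintype O] {L : ℕ}
    (P : (Fin (L + 1) → S) × (Fin L → O) → ℝ)
    (A : (Fin (L + 1) → S) × (Fin L → O) → Prop) : ℝ :=
  ∑ sy : (Fin (L + 1) → S) × (Fin L → O), if A sy then P sy else 0

/-- The conditional probability `P(A | B)`. -/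
noncomputable def condProb {S O : Type*} [Fintype S] [Fintype O] {L : ℕ}
    (P : (Fin (L + 1) → S) × (Fin L → O) → ℝ)
    (A B : (Fin (L + 1) → S) × (Fin L → O) → Prop) : ℝ :=
  prob P (fun sy => A sy ∧ B sy) / prob P B

open scoped Classical in
/-- Keep the coordinates of two functions in `J` and exchange those outside `J`. -/
noncomputable def exchangeOff {ι α : Type*} (J : Set ι) (u : (ι → α) × (ι → α)) :
    (ι → α) × (ι → α) :=
  (J.piecewise u.1 u.2, J.piecewise u.2 u.1)

theorem exchangeOff_exchangeOff {ι α : Type*} (J : Set ι) (u : (ι → α) × (ι → α)) :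
    exchangeOff J (exchangeOff J u) = u := by
  ext j <;> by_cases hj : j ∈ J <;> simp [exchangeOff, hj]

/-- Exchange the paths outside `J` and the observations outside `K`. -/
noncomputable def exchangePair {ι κ S O : Type*} (J : Set ι) (K : Set κ)
    (x : ((ι → S) × (κ → O)) × ((ι → S) × (κ → O))) :
    ((ι → S) × (κ → O)) × ((ι → S) × (κ → O)) :=
  (((exchangeOff J (x.1.1, x.2.1)).1, (exchangeOff K (x.1.2, x.2.2)).1),
    ((exchangeOff J (x.1.1, x.2.1)).2, (exchangeOff K (x.1.2, x.2.2)).2))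

theorem exchangePair_involutive {ι κ S O : Type*} (J : Set ι) (K : Set κ) :
    Function.Involutive (exchangePair (S := S) (O := O) J K) := by
  rintro ⟨⟨s₁, y₁⟩, s₂, y₂⟩
  simp [exchangePair, exchangeOff_exchangeOff]

open scoped Classical in
theorem prob_mul_prob {S O : Type*} [Fintype S] [Fintype O] {L : ℕ}
    (P : (Fin (L + 1) → S) × (Fin L → O) → ℝ)
    (A B : (Fin (L + 1) → S) × (Fin L → O) → Prop) :
    prob P A * prob P B = ∑ x : ((Fin (L + 1) → S) × (Fin L → O)) ×
      ((Fin (L + 1) → S) × (Fin L → O)), if A x.1 ∧ B x.2 then P x.1 * P x.2 else 0 := by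
  rw [prob, prob, Finset.sum_mul_sum, ← Fintype.sum_prod_type']
  refine Finset.sum_congr rfl fun x _ => ?_
  by_cases hA : A x.1 <;> by_cases hB : B x.2 <;> simp [hA, hB]

theorem prob_mono {S O : Type*} [Fintype S] [Fintype O] {L : ℕ}
    {P : (Fin (L + 1) → S) × (Fin L → O) → ℝ} (hP : ∀ x, 0 ≤ P x)
    {A B : (Fin (L + 1) → S) × (Fin L → O) → Prop} (h : ∀ x, A x → B x) :
    prob P A ≤ prob P B := by
  refine Finset.sum_le_sum fun x _ => ?_
  by_cases hA : A x
  · simp [hA, h x hA]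
  · simp only [hA, if_false]
    split_ifs
    exacts [hP x, le_rfl]

/-- If a transformation of pairs of outcomes preserves the product weight and carries one pair of
events to another, then the two products of probabilities agree. -/
theorem prob_mul_prob_eq_of_involutive {S O : Type*} [Fintype S] [Fintype O] {L : ℕ}
    {P : (Fin (L + 1) → S) × (Fin L → O) → ℝ}
    {A B C D : (Fin (L + 1) → S) × (Fin L → O) → Prop}
    {σ : ((Fin (L + 1) → S) × (Fin L → O)) × ((Fin (L + 1) → S) × (Fin L → O)) →
      ((Fin (L + 1) → S) × (Fin L → O)) × ((Fin (L + 1) → S) × (Fin L → O))}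
    (hσ : Function.Involutive σ) (hP : ∀ x, P (σ x).1 * P (σ x).2 = P x.1 * P x.2)
    (hev : ∀ x, A x.1 ∧ B x.2 ↔ C (σ x).1 ∧ D (σ x).2) :
    prob P A * prob P B = prob P C * prob P D := by
  classical
  rw [prob_mul_prob, prob_mul_prob]
  refine Fintype.sum_equiv hσ.toPerm _ _ fun x => ?_
  simp only [Function.Involutive.coe_toPerm, hP]
  exact if_congr (hev x) rfl rfl

/-- Exchanging everything outside a segment at whose endpoints both paths are in the same state
preserves the product of the Markov weights. -/
theorem markov_weight_exchange {S O : Type*} [Zero S] [DecidableEq S] {L : ℕ}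
    (w : O → S → S → ℝ) {P : (Fin (L + 1) → S) × (Fin L → O) → ℝ}
    (hP : ∀ s y, P (s, y) = (if s 0 = 0 then (1 : ℝ) else 0) *
      ∏ t : Fin L, w (y t) (s t.castSucc) (s t.succ))
    {a b : Fin (L + 1)} {s₁ s₂ : Fin (L + 1) → S} (y₁ y₂ : Fin L → O)
    (ha : s₁ a = s₂ a) (hb : s₁ b = s₂ b) {J : Set (Fin (L + 1))} {K : Set (Fin L)}
    (hJ : J = Set.Icc a b) (hK : K = {k : Fin L | (a : ℕ) < (k : ℕ) + 1 ∧ (k : ℕ) + 1 ≤ (b : ℕ)}) :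
    P (exchangePair J K ((s₁, y₁), (s₂, y₂))).1 * P (exchangePair J K ((s₁, y₁), (s₂, y₂))).2 =
      P (s₁, y₁) * P (s₂, y₂) := by
  classical
  simp only [exchangePair, exchangeOff, hP]
  rw [mul_mul_mul_comm, ← Finset.prod_mul_distrib, mul_mul_mul_comm (if s₁ 0 = 0 then (1 : ℝ) else 0),
    ← Finset.prod_mul_distrib]
  congr 1
  · by_cases h0 : (0 : Fin (L + 1)) ∈ J
    · simp [h0]
    · simp [h0, mul_comm]
  refine Finset.prod_congr rfl fun t _ => ?_
  by_cases ht : t ∈ K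
  · have hc : t.castSucc ∈ J := by
      simp only [hK, Set.mem_ofPred_eq, hJ, Set.mem_Icc, Fin.le_def, Fin.val_castSucc] at ht ⊢
      omega
    have hs : t.succ ∈ J := by
      simp only [hK, Set.mem_ofPred_eq, hJ, Set.mem_Icc, Fin.le_def, Fin.val_succ] at ht ⊢
      omega
    simp [ht, hc, hs]
  · have hbd : ∀ j ∈ ({t.castSucc, t.succ} : Set (Fin (L + 1))), j ∈ J → s₁ j = s₂ j := by
      intro j hj hjJ
      suffices j = a ∨ j = b by rcases this with rfl | rfl <;> assumption
      simp only [hK, Set.mem_ofPred_eq, hJ, Set.mem_Icc, Fin.le_def, Fin.ext_iff] at ht hjJ ⊢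
      rcases hj with rfl | rfl <;>
        simp only [Fin.val_castSucc, Fin.val_succ] at hjJ ⊢ <;> omega
    have hpw : ∀ j ∈ ({t.castSucc, t.succ} : Set (Fin (L + 1))),
        J.piecewise s₁ s₂ j = s₂ j ∧ J.piecewise s₂ s₁ j = s₁ j := by
      intro j hj
      by_cases hjJ : j ∈ J
      · simp [hjJ, hbd j hj hjJ]
      · simp [hjJ]
    obtain ⟨hc₁, hc₂⟩ := hpw t.castSucc (by simp)
    obtain ⟨hs₁, hs₂⟩ := hpw t.succ (by simp)
    rw [hc₁, hc₂, hs₁, hs₂, Set.piecewise_eq_of_notMem _ _ _ ht,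
      Set.piecewise_eq_of_notMem _ _ _ ht, mul_comm]

/-- **Serial and parallel a-posteriori probabilities of the information bits coincide.**
`f : S → Bool` assigns to each encoder state its most recent input bit
(`false` playing the role of the bit `0`), so the information bit at time `t+1` is
`f (s t.succ)`.  For every time `t` (lying in the `i`-th segment
`(Lb i.castSucc, Lb i.succ]`) and every observation sequence `y` with
`P(Y = y) > 0`, we have `P(b_t = 0 ∣ Y = y) = P(b_t = 0 ∣ Y_{i(t)} = y|_{i(t)})`. -/
theorem serial_parallel_APP_info_bits
    {S O : Type*} [Fintype S] [Fintype O] [Nonempty S] [Nonempty O]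
    [Zero S] [DecidableEq S]
    {N L : ℕ} (hN : 1 ≤ N) (hL : 1 ≤ L)
    -- boundary times 0 = L_0 < L_1 < ⋯ < L_N = L
    (Lb : Fin (N + 1) → Fin (L + 1)) (hmono : StrictMono Lb)
    (hLb0 : Lb 0 = 0) (hLbN : Lb (Fin.last N) = Fin.last L)
    -- the factorizing probability mass function
    (p : S → S → ℝ) (q : O → S → S → ℝ)
    (hp : ∀ a b, 0 ≤ p a b) (hq : ∀ o a b, 0 ≤ q o a b)
    (P : (Fin (L + 1) → S) × (Fin L → O) → ℝ)
    (hP : ∀ s y, P (s, y) =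
      (if s 0 = 0 then (1 : ℝ) else 0) *
        ∏ t : Fin L, p (s t.castSucc) (s t.succ) * q (y t) (s t.castSucc) (s t.succ))
    (hsum : ∑ sy : (Fin (L + 1) → S) × (Fin L → O), P sy = 1)
    -- termination: each parallel codeword drives the encoder back to state 0
    (hterm : ∀ s y, P (s, y) ≠ 0 → ∀ i : Fin (N + 1), s (Lb i) = 0)
    -- the input-bit map
    (f : S → Bool)
    -- the observation sequence, with positive serial probability
    (y : Fin L → O)
    (hy : 0 < prob P (fun sy => sy.2 = y))
    -- the time t (as an element of Fin L, representing time t+1) and its segment index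
    (t : Fin L) (i : Fin N)
    (hti : ((Lb i.castSucc : ℕ) < (t : ℕ) + 1) ∧ ((t : ℕ) + 1 ≤ (Lb i.succ : ℕ))) :
    condProb P (fun sy => f (sy.1 t.succ) = false) (fun sy => sy.2 = y) =
      condProb P (fun sy => f (sy.1 t.succ) = false)
        (fun sy => ∀ k : Fin L,
          (Lb i.castSucc : ℕ) < (k : ℕ) + 1 → (k : ℕ) + 1 ≤ (Lb i.succ : ℕ) →
            sy.2 k = y k) := by
  have hnn : ∀ x, 0 ≤ P x := fun x => by
    rw [← Prod.mk.eta (p := x), hP]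
    exact mul_nonneg (by split_ifs <;> norm_num)
      (Finset.prod_nonneg fun _ _ => mul_nonneg (hp _ _) (hq _ _ _))
  set a := Lb i.castSucc with ha
  set b := Lb i.succ with hb
  set J : Set (Fin (L + 1)) := Set.Icc a b with hJ
  set K : Set (Fin L) := {k | (a : ℕ) < (k : ℕ) + 1 ∧ (k : ℕ) + 1 ≤ (b : ℕ)} with hK
  have hab : a ≤ b := (hmono i.castSucc_lt_succ).le
  have haJ : a ∈ J := ⟨le_rfl, hab⟩
  have hbJ : b ∈ J := ⟨hab, le_rfl⟩
  have htJ : t.succ ∈ J := by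
    simp only [hJ, Set.mem_Icc, Fin.le_def, Fin.val_succ]
    omega
  have hzero : ∀ s y, ¬(s a = 0 ∧ s b = 0) → P (s, y) = 0 := fun s y h => by
    by_contra hne
    exact h ⟨hterm s y hne _, hterm s y hne _⟩
  have hweight : ∀ x, P (exchangePair J K x).1 * P (exchangePair J K x).2 = P x.1 * P x.2 := by
    rintro ⟨⟨s₁, y₁⟩, s₂, y₂⟩
    by_cases h₁ : s₁ a = 0 ∧ s₁ b = 0
    · by_cases h₂ : s₂ a = 0 ∧ s₂ b = 0
      · exact markov_weight_exchange (fun o c d => p c d * q o c d) hP y₁ y₂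
          (h₁.1.trans h₂.1.symm) (h₁.2.trans h₂.2.symm) hJ hK
      · have h : P (exchangePair J K ((s₁, y₁), (s₂, y₂))).2 = 0 :=
          hzero _ _ (by simpa [exchangeOff, haJ, hbJ] using h₂)
        simp only [h, hzero s₂ y₂ h₂, mul_zero]
    · have h : P (exchangePair J K ((s₁, y₁), (s₂, y₂))).1 = 0 :=
        hzero _ _ (by simpa [exchangeOff, haJ, hbJ] using h₁)
      simp only [h, hzero s₁ y₁ h₁, zero_mul]
  have hpar := hy.trans_le (prob_mono hnn (B := fun sy => ∀ k : Fin L,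
    (a : ℕ) < (k : ℕ) + 1 → (k : ℕ) + 1 ≤ (b : ℕ) → sy.2 k = y k) fun x hx k _ _ => by rw [hx])
  rw [condProb, condProb, div_eq_div_iff hy.ne' hpar.ne']
  refine prob_mul_prob_eq_of_involutive (exchangePair_involutive J K) hweight ?_
  rintro ⟨⟨s₁, y₁⟩, s₂, y₂⟩
  simp only [exchangePair, exchangeOff, Set.piecewise_eq_of_mem, htJ, and_assoc, funext_iff,
    ← forall_and]
  refine and_congr_right fun _ => forall_congr' fun k => ?_
  by_cases hk : k ∈ K
  · simp only [Set.piecewise_eq_of_mem, hk]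
    simp only [hK, Set.mem_ofPred_eq] at hk
    simp only [hk.1, hk.2, forall_const]
  · simp only [Set.piecewise_eq_of_notMem, hk, not_false_eq_true]
    simp only [hK, Set.mem_ofPred_eq] at hk
    tauto
end

section
/- The serial and parallel a-posteriori state distributions coincide: for every t ∈ {1,…,L}, every state m ∈ S, and every observation sequence y with P(Y = y) > 0, one has P(S_t = m | Y = y) = P(S_t = m | Y_{i(t)} = y|_{i(t)}). -/
/-- The pair of state path and observation sequence that follows `x'` at the times in `(a, b]`
and `x` at all other times. -/
def splice {S O : Type*} {L : ℕ} (a b : ℕ) (x x' : (Fin (L + 1) → S) × (Fin L → O)) :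
    (Fin (L + 1) → S) × (Fin L → O) :=
  (fun j => if a < (j : ℕ) ∧ (j : ℕ) ≤ b then x'.1 j else x.1 j,
    fun k => if a < (k : ℕ) + 1 ∧ (k : ℕ) + 1 ≤ b then x'.2 k else x.2 k)

theorem splice_splice {S O : Type*} {L : ℕ} (a b : ℕ)
    (x x' : (Fin (L + 1) → S) × (Fin L → O)) :
    splice a b (splice a b x x') (splice a b x' x) = x := by
  ext j <;> simp only [splice] <;> split_ifs <;> rfl

/-- Exchanging the segments `(a, b]` of two pairs. -/
def spliceEquiv (S O : Type*) (L a b : ℕ) :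
    Equiv.Perm (((Fin (L + 1) → S) × (Fin L → O)) × ((Fin (L + 1) → S) × (Fin L → O))) where
  toFun z := (splice a b z.1 z.2, splice a b z.2 z.1)
  invFun z := (splice a b z.1 z.2, splice a b z.2 z.1)
  left_inv z := by simp only [splice_splice]
  right_inv z := by simp only [splice_splice]

/-- If the weight of a pair of outcomes is invariant under exchanging segments, then products of
probabilities of events that correspond under this exchange agree. -/
theorem prob_mul_prob_eq_of_splice {S O : Type*} [Fintype S] [Fintype O] {L : ℕ} (a b : ℕ)
    (P : (Fin (L + 1) → S) × (Fin L → O) → ℝ)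
    (hP : ∀ x x', P (splice a b x x') * P (splice a b x' x) = P x * P x')
    {A B A' B' : (Fin (L + 1) → S) × (Fin L → O) → Prop}
    (h : ∀ x x', A' (splice a b x x') ∧ B' (splice a b x' x) ↔ A x ∧ B x') :
    prob P A * prob P B = prob P A' * prob P B' := by
  classical
  have key : ∀ A B : (Fin (L + 1) → S) × (Fin L → O) → Prop, prob P A * prob P B =
      ∑ z : ((Fin (L + 1) → S) × (Fin L → O)) × ((Fin (L + 1) → S) × (Fin L → O)),
        if A z.1 ∧ B z.2 then P z.1 * P z.2 else 0 := by
    intro A B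
    simp only [prob]
    rw [Fintype.sum_mul_sum, Fintype.sum_prod_type
      (f := fun z : ((Fin (L + 1) → S) × (Fin L → O)) × ((Fin (L + 1) → S) × (Fin L → O)) =>
        if A z.1 ∧ B z.2 then P z.1 * P z.2 else 0)]
    refine Finset.sum_congr rfl fun x _ => Finset.sum_congr rfl fun x' _ => ?_
    by_cases hA : A x <;> by_cases hB : B x' <;> simp [hA, hB]
  symm
  rw [key, key, ← Equiv.sum_comp (spliceEquiv S O L a b)]
  refine Finset.sum_congr rfl fun z _ => ?_
  simp only [spliceEquiv, Equiv.coe_fn_mk, hP, h]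

/-- For a weight that factorizes along the path, exchanging the segments between two times at which
both paths agree leaves the product of the weights unchanged. -/
theorem mul_splice_of_factorizes {S O : Type*} [Zero S] [DecidableEq S] {L : ℕ}
    (p : S → S → ℝ) (q : O → S → S → ℝ) (P : (Fin (L + 1) → S) × (Fin L → O) → ℝ)
    (hP : ∀ s y, P (s, y) =
      (if s 0 = 0 then (1 : ℝ) else 0) *
        ∏ t : Fin L, p (s t.castSucc) (s t.succ) * q (y t) (s t.castSucc) (s t.succ))
    (a b : Fin (L + 1)) (x x' : (Fin (L + 1) → S) × (Fin L → O))
    (ha : x.1 a = x'.1 a) (hb : x.1 b = x'.1 b) :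
    P (splice a b x x') * P (splice a b x' x) = P x * P x' := by
  obtain ⟨s, y⟩ := x
  obtain ⟨s', y'⟩ := x'
  dsimp only at ha hb
  simp only [splice, hP, Fin.val_zero, not_lt_zero, false_and, if_false]
  refine (mul_mul_mul_comm _ _ _ _).trans (Eq.trans ?_ (mul_mul_mul_comm _ _ _ _))
  rw [← Finset.prod_mul_distrib, ← Finset.prod_mul_distrib]
  congr 1
  refine Finset.prod_congr rfl fun k _ => ?_
  have hka : (k : ℕ) = a → s k.castSucc = s' k.castSucc := fun h => by
    rwa [show k.castSucc = a from Fin.ext h]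
  have hkb : (k : ℕ) = b → s k.castSucc = s' k.castSucc := fun h => by
    rwa [show k.castSucc = b from Fin.ext h]
  simp only [Fin.val_castSucc, Fin.val_succ]
  by_cases h₁ : (a : ℕ) < k + 1 ∧ (k : ℕ) + 1 ≤ b <;>
    by_cases h₂ : (a : ℕ) < k ∧ (k : ℕ) ≤ b <;> simp only [h₁, h₂, and_self, if_true, if_false]
  · ring
  · rw [hka (by omega)]; ring
  · rw [hkb (by omega)]

/-- **Serial and parallel a-posteriori state distributions coincide.** -/
theorem serial_parallel_APP_states
    {S O : Type*} [Fintype S] [Fintype O] [Nonempty S] [Nonempty O]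
    [Zero S] [DecidableEq S]
    {N L : ℕ} (hN : 1 ≤ N) (hL : 1 ≤ L)
    -- boundary times 0 = L_0 < L_1 < ⋯ < L_N = L
    (Lb : Fin (N + 1) → Fin (L + 1)) (hmono : StrictMono Lb)
    (hLb0 : Lb 0 = 0) (hLbN : Lb (Fin.last N) = Fin.last L)
    -- the factorizing probability mass function
    (p : S → S → ℝ) (q : O → S → S → ℝ)
    (hp : ∀ a b, 0 ≤ p a b) (hq : ∀ o a b, 0 ≤ q o a b)
    (P : (Fin (L + 1) → S) × (Fin L → O) → ℝ)
    (hP : ∀ s y, P (s, y) =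
      (if s 0 = 0 then (1 : ℝ) else 0) *
        ∏ t : Fin L, p (s t.castSucc) (s t.succ) * q (y t) (s t.castSucc) (s t.succ))
    (hsum : ∑ sy : (Fin (L + 1) → S) × (Fin L → O), P sy = 1)
    -- termination: each parallel codeword drives the encoder back to state 0
    (hterm : ∀ s y, P (s, y) ≠ 0 → ∀ i : Fin (N + 1), s (Lb i) = 0)
    -- the state
    (m : S)
    -- the observation sequence, with positive serial probability
    (y : Fin L → O)
    (hy : 0 < prob P (fun sy => sy.2 = y))
    -- the time t (as an element of Fin L, representing time t+1) and its segment index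
    (t : Fin L) (i : Fin N)
    (hti : ((Lb i.castSucc : ℕ) < (t : ℕ) + 1) ∧ ((t : ℕ) + 1 ≤ (Lb i.succ : ℕ))) :
    condProb P (fun sy => sy.1 t.succ = m) (fun sy => sy.2 = y) =
      condProb P (fun sy => sy.1 t.succ = m)
        (fun sy => ∀ k : Fin L,
          (Lb i.castSucc : ℕ) < (k : ℕ) + 1 → (k : ℕ) + 1 ≤ (Lb i.succ : ℕ) →
            sy.2 k = y k) := by
  set a := Lb i.castSucc
  set b := Lb i.succ
  have hab : (a : ℕ) < b := hmono i.castSucc_lt_succ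
  have hswap : ∀ x x', P (splice a b x x') * P (splice a b x' x) = P x * P x' := by
    intro x x'
    by_cases h : x.1 a = x'.1 a ∧ x.1 b = x'.1 b
    · exact mul_splice_of_factorizes p q P hP a b x x' h.1 h.2
    · have hzero : ∀ z z' : (Fin (L + 1) → S) × (Fin L → O),
          ¬(z.1 a = z'.1 a ∧ z.1 b = z'.1 b) → P z * P z' = 0 := by
        intro z z' hz
        by_contra hne
        have h₁ := hterm z.1 z.2 (left_ne_zero_of_mul hne)
        have h₂ := hterm z'.1 z'.2 (right_ne_zero_of_mul hne)
        exact hz ⟨(h₁ _).trans (h₂ _).symm, (h₁ _).trans (h₂ _).symm⟩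
      rw [hzero x x' h, hzero]
      simpa [splice, Fin.lt_def.2 hab, eq_comm] using h
  have hnonneg : ∀ x, 0 ≤ P x := by
    rintro ⟨s, z⟩
    rw [hP]
    exact mul_nonneg (by split_ifs <;> norm_num)
      (Finset.prod_nonneg fun k _ => mul_nonneg (hp _ _) (hq _ _ _))
  have hpos : 0 < prob P (fun sy => ∀ k : Fin L,
      (a : ℕ) < (k : ℕ) + 1 → (k : ℕ) + 1 ≤ (b : ℕ) → sy.2 k = y k) := by
    refine hy.trans_le (Finset.sum_le_sum fun x _ => ?_)
    by_cases hx : x.2 = y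
    · simp [hx]
    · simp only [hx, if_false]
      split_ifs
      exacts [hnonneg x, le_rfl]
  unfold condProb
  rw [div_eq_div_iff hy.ne' hpos.ne', mul_comm (prob P _) (prob P fun sy => sy.2 = y)]
  refine prob_mul_prob_eq_of_splice a b P hswap fun x x' => ?_
  have ht : (a : ℕ) < (t.succ : ℕ) ∧ (t.succ : ℕ) ≤ b := by simpa using hti
  simp only [splice, if_pos ht, funext_iff]
  constructor
  · rintro ⟨hS, hm, hB⟩
    refine ⟨⟨hm, fun k => ?_⟩, fun k h₁ h₂ => ?_⟩
    · by_cases hk : (a : ℕ) < (k : ℕ) + 1 ∧ (k : ℕ) + 1 ≤ b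
      · simpa only [if_pos hk] using hB k hk.1 hk.2
      · simpa only [if_neg hk] using hS k
    · simpa only [if_pos (And.intro h₁ h₂)] using hS k
  · rintro ⟨⟨hm, hS⟩, hB⟩
    refine ⟨fun k => ?_, hm, fun k h₁ h₂ => ?_⟩
    · split_ifs with hk
      exacts [hB k hk.1 hk.2, hS k]
    · simpa only [if_pos (And.intro h₁ h₂)] using hS k
end

section
/- The Viterbi decoding of the serial concatenation is the concatenation of the parallel Viterbi decodings: fix boundary times 0 = L_0 < L_1 < ⋯ < L_N = L and branch metrics w : {1,…,L} → S → S → EReal that never take the value +∞. For each i ∈ {1,…,N}, let A_i be the set of segment paths σ : {L_{i−1}, L_{i−1}+1, …, L_i} → S with σ(L_{i−1}) = σ(L_i) = 0, with segment metric M_i(σ) = ∑_{t=L_{i−1}+1}^{L_i} w t (σ(t−1)) (σ(t)); assume that for each i there is a segment path σ_i ∈ A_i with M_i(σ_i) > −∞ and M_i(σ_i) > M_i(σ) for every σ ∈ A_i with σ ≠ σ_i (a unique strict maximizer). Call a path π : Fin (L+1) → S constrained if π(L_i) = 0 for all i ∈ {0,…,N}, with total metric M(π) = ∑_{t=1}^{L}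 w t (π(t−1)) (π(t)). Then the glued path π* defined by π*(t) = σ_i(t) for L_{i−1} ≤ t ≤ L_i (well-defined since all σ_i take the value 0 at the boundaries) is constrained, satisfies M(π*) = ∑_{i=1}^{N} M_i(σ_i) > −∞, and is the unique strict maximizer of M over all constrained paths: M(π*) > M(π) for every constrained path π ≠ π*. -/
/-!
Trellis model for Viterbi decoding: a finite nonempty type `S` of states with a
distinguished state `0`.  A path is a function `π : Fin (L+1) → S`; the index
`t : Fin L` represents the trellis section (transition time) `t+1 ∈ {1,…,L}`.
Segment paths for the block with boundary times `a ≤ b` are modelled as functions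
`σ : ℕ → S` (only the values on `{a, a+1, …, b}` matter).
-/

/-- The total path metric of `π` for branch metrics `w`. -/
noncomputable def pathMetric {S : Type*} {L : ℕ} (w : Fin L → S → S → EReal)
    (π : Fin (L + 1) → S) : EReal :=
  ∑ t : Fin L, w t (π t.castSucc) (π t.succ)

/-- The segment metric `M_i(σ) = ∑_{t = a+1}^{b} w t (σ (t-1)) (σ t)` of a segment
path `σ` over the trellis sections strictly after `a` and up to `b`. -/
noncomputable def segMetric {S : Type*} {L : ℕ} (w : Fin L → S → S → EReal)
    (a b : ℕ) (σ : ℕ → S) : EReal :=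
  ∑ t ∈ Finset.univ.filter (fun t : Fin L => a ≤ (t : ℕ) ∧ (t : ℕ) < b),
    w t (σ (t : ℕ)) (σ ((t : ℕ) + 1))

theorem segMetric_congr {S : Type*} {L : ℕ} (w : Fin L → S → S → EReal) {a b : ℕ}
    {σ τ : ℕ → S} (h : ∀ k, a ≤ k → k ≤ b → σ k = τ k) :
    segMetric w a b σ = segMetric w a b τ := by
  refine Finset.sum_congr rfl fun t ht => ?_
  simp only [Finset.mem_filter, Finset.mem_univ, true_and] at ht
  rw [h t ht.1 ht.2.le, h (t + 1) (by lia) (by lia)]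

theorem segMetric_add {S : Type*} {L : ℕ} (w : Fin L → S → S → EReal) {a b c : ℕ}
    (hab : a ≤ b) (hbc : b ≤ c) (σ : ℕ → S) :
    segMetric w a b σ + segMetric w b c σ = segMetric w a c σ := by
  unfold segMetric
  rw [← Finset.sum_union]
  · congr 1
    ext t
    simp only [Finset.mem_union, Finset.mem_filter, Finset.mem_univ, true_and]
    lia
  · rw [Finset.disjoint_left]
    intro t
    simp only [Finset.mem_filter, Finset.mem_univ, true_and]
    lia

theorem sum_segMetric {S : Type*} {L : ℕ} (w : Fin L → S → S → EReal) (σ : ℕ → S) :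
    ∀ {n : ℕ} (f : Fin (n + 1) → ℕ), Monotone f →
      ∑ i : Fin n, segMetric w (f i.castSucc) (f i.succ) σ =
        segMetric w (f 0) (f (Fin.last n)) σ
  | 0, f, _ => by
    rw [Fin.sum_univ_zero, segMetric, Finset.sum_eq_zero]
    intro t ht
    simp only [Finset.mem_filter, Finset.mem_univ, true_and, Fin.last_zero] at ht
    lia
  | n + 1, f, hf => by
    rw [Fin.sum_univ_castSucc]
    have ih := sum_segMetric w σ (fun i : Fin (n + 1) => f i.castSucc)
      (hf.comp Fin.strictMono_castSucc.monotone)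
    simp only [← Fin.succ_castSucc] at ih ⊢
    rw [ih, Fin.succ_last]
    exact segMetric_add w (hf (Fin.zero_le _)) (hf (Fin.le_last _)) σ

theorem exists_segment_of_mem_range {n : ℕ} (f : Fin (n + 1) → ℕ) (hn : 1 ≤ n) {k : ℕ}
    (h0 : f 0 ≤ k) (hk : k ≤ f (Fin.last n)) :
    ∃ i : Fin n, f i.castSucc ≤ k ∧ k ≤ f i.succ := by
  by_contra! h
  have key : ∀ i : Fin (n + 1), i ≠ 0 → f i < k := by
    intro i
    induction i using Fin.induction with
    | zero => simp
    | succ i ih =>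
      intro _
      refine h i ?_
      by_cases hi : i.castSucc = 0
      · rwa [hi]
      · exact (ih hi).le
  exact (key (Fin.last n) (by simp [Fin.ext_iff]; lia)).not_ge hk

theorem EReal.sum_ne_top {ι : Type*} {s : Finset ι} {f : ι → EReal}
    (h : ∀ i ∈ s, f i ≠ ⊤) : ∑ i ∈ s, f i ≠ ⊤ :=
  Finset.sum_induction f (· ≠ ⊤) (fun _ _ => EReal.add_ne_top) EReal.zero_ne_top h

theorem EReal.sum_ne_bot {ι : Type*} {s : Finset ι} {f : ι → EReal}
    (h : ∀ i ∈ s, f i ≠ ⊥) : ∑ i ∈ s, f i ≠ ⊥ :=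
  Finset.sum_induction f (· ≠ ⊥) (fun _ _ ha hb => EReal.add_ne_bot_iff.2 ⟨ha, hb⟩)
    EReal.zero_ne_bot h

theorem EReal.sum_lt_sum_of_ne {ι : Type*} {s : Finset ι} {f g : ι → EReal}
    (hle : ∀ i ∈ s, f i ≤ g i) (hlt : ∃ i ∈ s, f i < g i)
    (hbot : ∀ i ∈ s, g i ≠ ⊥) (htop : ∀ i ∈ s, g i ≠ ⊤) :
    ∑ i ∈ s, f i < ∑ i ∈ s, g i := by
  classical
  obtain ⟨j, hj, hjlt⟩ := hlt
  rw [← Finset.add_sum_erase s f hj, ← Finset.add_sum_erase s g hj]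
  exact EReal.add_lt_add_of_lt_of_le' hjlt
    (Finset.sum_le_sum fun i hi => hle i (Finset.mem_of_mem_erase hi))
    (EReal.sum_ne_bot fun i hi => hbot i (Finset.mem_of_mem_erase hi))
    fun h => absurd h (EReal.sum_ne_top fun i hi => htop i (Finset.mem_of_mem_erase hi))

/-- The extension of a path to all of `ℕ`, constant after the final time. -/
def pathExtend {S : Type*} {L : ℕ} (π : Fin (L + 1) → S) (k : ℕ) : S :=
  π ⟨min k L, by lia⟩

theorem pathExtend_val {S : Type*} {L : ℕ} (π : Fin (L + 1) → S) (k : Fin (L + 1)) :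
    pathExtend π k = π k := by
  unfold pathExtend
  congr 1
  ext
  simp only
  lia

theorem pathMetric_eq_segMetric {S : Type*} {L : ℕ} (w : Fin L → S → S → EReal)
    (π : Fin (L + 1) → S) : pathMetric w π = segMetric w 0 L (pathExtend π) := by
  unfold pathMetric segMetric
  rw [Finset.filter_true_of_mem fun t _ => ⟨t.val.zero_le, t.isLt⟩]
  refine Finset.sum_congr rfl fun t _ => ?_
  rw [← pathExtend_val π t.castSucc, ← pathExtend_val π t.succ, Fin.val_castSucc, Fin.val_succ]

theorem pathMetric_eq_sum_segMetric {S : Type*} {N L : ℕ} (w : Fin L → S → S → EReal)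
    (Lb : Fin (N + 1) → Fin (L + 1)) (hmono : Monotone Lb)
    (hLb0 : Lb 0 = 0) (hLbN : Lb (Fin.last N) = Fin.last L) (π : Fin (L + 1) → S) :
    pathMetric w π =
      ∑ i : Fin N, segMetric w (Lb i.castSucc : ℕ) (Lb i.succ : ℕ) (pathExtend π) := by
  rw [sum_segMetric w (pathExtend π) (fun i => (Lb i : ℕ)) fun _ _ h => hmono h,
    pathMetric_eq_segMetric, hLb0, hLbN, Fin.val_zero, Fin.val_last]

/-- **The Viterbi decoding of the serial concatenation is the concatenation of the
parallel Viterbi decodings.**  With boundary times `0 = L_0 < L_1 < ⋯ < L_N = L`,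
branch metrics never equal to `+∞`, and for each segment `i` a unique strict
maximizer `σ i` (with finite metric) of the segment metric over all segment paths
with zero boundary values, the glued path `π*` (agreeing with `σ i` on the `i`-th
segment) is constrained (zero at all boundary times), its total metric is the sum
of the segment metrics of the `σ i` and is `> −∞`, and it is the unique strict
maximizer of the total metric over all constrained paths. -/
theorem viterbi_serial_concatenation
    {S : Type*} [Fintype S] [Nonempty S] [Zero S]
    {N L : ℕ} (hN : 1 ≤ N) (hL : 1 ≤ L)
    -- boundary times 0 = L_0 < L_1 < ⋯ < L_N = L
    (Lb : Fin (N + 1) → Fin (L + 1)) (hmono : StrictMono Lb)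
    (hLb0 : Lb 0 = 0) (hLbN : Lb (Fin.last N) = Fin.last L)
    -- branch metrics, never +∞
    (w : Fin L → S → S → EReal) (hw : ∀ t a b, w t a b ≠ ⊤)
    -- the segment maximizers σ i
    (σ : Fin N → ℕ → S)
    (hσbd : ∀ i : Fin N, σ i (Lb i.castSucc : ℕ) = 0 ∧ σ i (Lb i.succ : ℕ) = 0)
    (hσfin : ∀ i : Fin N,
      ⊥ < segMetric w (Lb i.castSucc : ℕ) (Lb i.succ : ℕ) (σ i))
    (hσmax : ∀ i : Fin N, ∀ τ : ℕ → S,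
      τ (Lb i.castSucc : ℕ) = 0 → τ (Lb i.succ : ℕ) = 0 →
      (∃ k : ℕ, (Lb i.castSucc : ℕ) ≤ k ∧ k ≤ (Lb i.succ : ℕ) ∧ τ k ≠ σ i k) →
      segMetric w (Lb i.castSucc : ℕ) (Lb i.succ : ℕ) τ <
        segMetric w (Lb i.castSucc : ℕ) (Lb i.succ : ℕ) (σ i))
    -- the glued path π*
    (πstar : Fin (L + 1) → S)
    (hglue : ∀ i : Fin N, ∀ k : Fin (L + 1),
      (Lb i.castSucc : ℕ) ≤ (k : ℕ) → (k : ℕ) ≤ (Lb i.succ : ℕ) → πstar k = σ i (k : ℕ)) :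
    -- π* is constrained
    (∀ i : Fin (N + 1), πstar (Lb i) = 0) ∧
    -- its metric is the sum of the segment metrics, and is > −∞
    pathMetric w πstar =
      ∑ i : Fin N, segMetric w (Lb i.castSucc : ℕ) (Lb i.succ : ℕ) (σ i) ∧
    ⊥ < pathMetric w πstar ∧
    -- π* is the unique strict maximizer over all constrained paths
    (∀ π : Fin (L + 1) → S, (∀ i : Fin (N + 1), π (Lb i) = 0) → π ≠ πstar →
      pathMetric w π < pathMetric w πstar) := by
  have hseg : ∀ k : Fin (L + 1), ∃ i : Fin N,
      (Lb i.castSucc : ℕ) ≤ k ∧ (k : ℕ) ≤ Lb i.succ := fun k =>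
    exists_segment_of_mem_range (fun i => (Lb i : ℕ)) hN (by simp [hLb0])
      (by simpa [hLbN] using k.is_le)
  have hle (i : Fin N) : (Lb i.castSucc : ℕ) ≤ Lb i.succ :=
    hmono.monotone (Fin.castSucc_lt_succ (i := i)).le
  have hstar (i : Fin N) (k : ℕ) (hk : (Lb i.castSucc : ℕ) ≤ k) (hk' : k ≤ Lb i.succ) :
      pathExtend πstar k = σ i k := by
    have hkL : k < L + 1 := hk'.trans_lt (Lb i.succ).isLt
    exact (pathExtend_val πstar ⟨k, hkL⟩).trans (hglue i ⟨k, hkL⟩ hk hk')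
  have hsum : pathMetric w πstar =
      ∑ i : Fin N, segMetric w (Lb i.castSucc : ℕ) (Lb i.succ : ℕ) (σ i) := by
    rw [pathMetric_eq_sum_segMetric w Lb hmono.monotone hLb0 hLbN]
    exact Finset.sum_congr rfl fun i _ => segMetric_congr w (hstar i)
  refine ⟨fun i => ?_, hsum, ?_, fun π hπ hne => ?_⟩
  · cases i using Fin.cases with
    | zero =>
      have h := hglue ⟨0, hN⟩ (Lb 0) le_rfl (hle ⟨0, hN⟩)
      exact h.trans (hσbd ⟨0, hN⟩).1
    | succ i => exact (hglue i _ (hle i) le_rfl).trans (hσbd i).2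
  · rw [hsum]
    exact bot_lt_iff_ne_bot.2 (EReal.sum_ne_bot fun i _ => (hσfin i).ne')
  · have hlt (i : Fin N) (k : ℕ) (hk : (Lb i.castSucc : ℕ) ≤ k) (hk' : k ≤ Lb i.succ)
        (hki : pathExtend π k ≠ σ i k) :
        segMetric w (Lb i.castSucc : ℕ) (Lb i.succ : ℕ) (pathExtend π) <
          segMetric w (Lb i.castSucc : ℕ) (Lb i.succ : ℕ) (σ i) :=
      hσmax i _ ((pathExtend_val π _).trans (hπ _)) ((pathExtend_val π _).trans (hπ _))
        ⟨k, hk, hk', hki⟩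
    rw [hsum, pathMetric_eq_sum_segMetric w Lb hmono.monotone hLb0 hLbN]
    refine EReal.sum_lt_sum_of_ne (fun i _ => ?_) ?_ (fun i _ => (hσfin i).ne')
      fun i _ => EReal.sum_ne_top fun t _ => hw t _ _
    · by_cases h : ∃ k : ℕ, (Lb i.castSucc : ℕ) ≤ k ∧ k ≤ Lb i.succ ∧ pathExtend π k ≠ σ i k
      · obtain ⟨k, hk, hk', hki⟩ := h
        exact (hlt i k hk hk' hki).le
      · push Not at h
        exact (segMetric_congr w h).le
    · obtain ⟨k, hk⟩ := Function.ne_iff.1 hne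
      obtain ⟨i, hi, hi'⟩ := hseg k
      refine ⟨i, Finset.mem_univ i, hlt i k hi hi' ?_⟩
      rwa [pathExtend_val, ← hglue i k hi hi']
end
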